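/- Let G be a finite group. If every cyclic subgroup of G of prime order and every cyclic subgroup of G of order 4 is c-normal in G, then G is supersoluble. -/

import Mathlib

open scoped Pointwise

/-- A group `G` is `p`-nilpotent if it has a normal `p`-complement, i.e. a normal
subgroup `N` whose order is not divisible by `p` and whose index is a power of `p`. -/
def IsPNilpotent (p : ℕ) (G : Type*) [Group G] : Prop :=
  ∃ N : Subgroup G, N.Normal ∧ ¬ p ∣ Nat.card N ∧ ∃ k : ℕ, N.index = p ^ k

/-- A subgroup `H` of `G` is c-normal in `G` if there is a normal subgroup `T`
with `G = HT` and `H ⊓ T` contained in the normal core of `H`. -/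
def Subgroup.IsCNormal {G : Type*} [Group G] (H : Subgroup G) : Prop :=
  ∃ T : Subgroup G, T.Normal ∧ (H : Set G) * (T : Set G) = Set.univ ∧ H ⊓ T ≤ H.normalCore

/-- A subgroup `H` of `G` is S-quasinormal in `G` if it permutes with every Sylow
subgroup of `G`. -/
def Subgroup.IsSQuasinormal {G : Type*} [Group G] (H : Subgroup G) : Prop :=
  ∀ q : ℕ, q.Prime → ∀ Q : Sylow q G,
    (H : Set G) * ((Q : Subgroup G) : Set G) = ((Q : Subgroup G) : Set G) * (H : Set G)

/-- A subgroup `H` of `G` has a `p`-nilpotent supplement in `G` if there is a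
subgroup `K` with `G = HK` and `K` `p`-nilpotent. -/
def HasPNilpotentSupplement (p : ℕ) {G : Type*} [Group G] (H : Subgroup G) : Prop :=
  ∃ K : Subgroup G, (H : Set G) * (K : Set G) = Set.univ ∧ IsPNilpotent p K

/-- `M` is a maximal (proper) subgroup of `P`. -/
def IsMaximalSubgroupOf {G : Type*} [Group G] (M P : Subgroup G) : Prop :=
  M < P ∧ ∀ K : Subgroup G, M < K → K ≤ P → K = P

/-- `P` is a Sylow `p`-subgroup of the subgroup `E`: a maximal `p`-subgroup of `E`. -/
def IsSylowSubgroupOf (p : ℕ) {G : Type*} [Group G] (P E : Subgroup G) : Prop :=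
  P ≤ E ∧ IsPGroup p P ∧ ∀ Q : Subgroup G, Q ≤ E → IsPGroup p Q → P ≤ Q → Q = P

/-- A group is supersolvable if it has a chain of subgroups from `⊥` to `⊤`,
each normal in `G`, in which each successive quotient is cyclic (i.e. each step
is generated by the previous one together with a single element). -/
def IsSupersolvable (G : Type*) [Group G] : Prop :=
  ∃ (n : ℕ) (c : ℕ → Subgroup G), c 0 = ⊥ ∧ c n = ⊤ ∧
    (∀ i, c i ≤ c (i + 1)) ∧ (∀ i, (c i).Normal) ∧
    ∀ i, ∃ x ∈ c (i + 1), c i ⊔ Subgroup.zpowers x = c (i + 1)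

open scoped commutatorElement

/-- Power formula in class two. -/
lemma class_two_pow {P : Type*} [Group P] (x c z : P) (hz : ∀ g, g * z = z * g)
    (h : c * x = x * c * z) (n : ℕ) : (x * c) ^ n = x ^ n * c ^ n * z ^ (n * (n - 1) / 2) := by
  have hzc : ∀ (m : ℕ) g, g * z ^ m = z ^ m * g := fun m g =>
    ((show Commute g z from hz g).pow_right m)
  have hc : ∀ n : ℕ, c ^ n * x = x * c ^ n * z ^ n := by
    intro n
    induction n with
    | zero => simp
    | succ k ih =>
      rw [pow_succ', mul_assoc, ih]
      calc c * (x * c ^ k * z ^ k) = (c * x) * c ^ k * z ^ k := by group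
        _ = x * c * (z * c ^ k) * z ^ k := by rw [h]; group
        _ = x * c * (c ^ k * z) * z ^ k := by rw [← hz]
        _ = x * (c * c ^ k) * z ^ (k + 1) := by rw [pow_succ']; group
  induction n with
  | zero => simp
  | succ k ih =>
    rw [pow_succ, ih]
    have e : (k + 1) * (k + 1 - 1) / 2 = k * (k - 1) / 2 + k := by
      rw [← Nat.choose_two_right, ← Nat.choose_two_right, Nat.choose_succ_succ' k 1]; simp; ring
    rw [e]
    set m := k * (k - 1) / 2
    calc x ^ k * c ^ k * z ^ m * (x * c) = x ^ k * c ^ k * (z ^ m * (x * c)) := by group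
      _ = x ^ k * c ^ k * ((x * c) * z ^ m) := by rw [hzc]
      _ = x ^ k * (c ^ k * x) * c * z ^ m := by group
      _ = x ^ k * x * c ^ k * (z ^ k * c) * z ^ m := by rw [hc]; group
      _ = x ^ k * x * c ^ k * (c * z ^ k) * z ^ m := by rw [← hzc k c]
      _ = (x ^ k * x) * (c ^ k * c) * (z ^ k * z ^ m) := by group
      _ = _ := by rw [← pow_succ, ← pow_succ, ← pow_add, add_comm k m]

lemma exists_frattini_like {p : ℕ} [Fact p.Prime] {P : Type*} [Group P] [Finite P] [Nontrivial P]
    (hP : IsPGroup p P) : ∃ F : Subgroup P, F ≠ ⊤ ∧ commutator P ≤ F ∧ (∀ x, x ^ p ∈ F) ∧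
      ∀ f : P →* P, ∀ x ∈ F, f x ∈ F := by
  refine ⟨(powMonoidHom p : Abelianization P →* Abelianization P).range.comap Abelianization.of,
    ?_, ?_, ?_, ?_⟩
  · intro htop
    have hs : Function.Surjective (powMonoidHom p : Abelianization P →* Abelianization P) := by
      rw [← MonoidHom.range_eq_top, eq_top_iff]
      rintro a -
      obtain ⟨x, rfl⟩ := QuotientGroup.mk_surjective a
      have : x ∈ (⊤ : Subgroup P) := trivial
      rw [← htop] at this
      exact this
    have hi := Finite.injective_iff_surjective.mpr hs
    have hone : ∀ a : Abelianization P, a = 1 := by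
      intro a
      obtain ⟨k, hk⟩ := hP.of_surjective Abelianization.of QuotientGroup.mk_surjective a
      induction k with
      | zero => simpa using hk
      | succ k ih =>
        apply ih
        apply hi
        simp only [powMonoidHom_apply, one_pow]
        rw [← pow_mul, ← pow_succ, hk]
    have := hP.isNilpotent
    have hlt := Group.IsSolvable.commutator_lt_top_of_nontrivial P
    apply hlt.ne
    rw [eq_top_iff]
    intro x _
    rw [← Abelianization.ker_of, MonoidHom.mem_ker]
    exact hone _
  · intro x hx
    have : Abelianization.of x = 1 := by
      rwa [← MonoidHom.mem_ker, Abelianization.ker_of]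
    rw [Subgroup.mem_comap, this]; exact one_mem _
  · intro x
    exact ⟨Abelianization.of x, by simp⟩
  · rintro f x ⟨y, hy⟩
    refine ⟨Abelianization.map f y, ?_⟩
    rw [← Abelianization.map_of, ← hy]; simp

/-- An endomorphism of a finite `p`-group of order prime to `p` that fixes all elements of order
`p` (and `4` if `p = 2`) is trivial. -/
lemma coprime_fix {p : ℕ} [hp : Fact p.Prime] (m : ℕ) : ∀ {P : Type*} [Group P] [Finite P]
    (_ : Nat.card P ≤ m) (_ : IsPGroup p P) (σ : P →* P) (n : ℕ) (_ : p.Coprime n)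
    (_ : ∀ x, σ^[n] x = x) (_ : ∀ x, x ^ p = 1 → σ x = x) (_ : p = 2 → ∀ x, x ^ 4 = 1 → σ x = x),
    ∀ x, σ x = x := by
  induction m with
  | zero =>
    intro P _ _ hc
    have : 0 < Nat.card P := Nat.card_pos
    omega
  | succ m ih =>
    intro P _ _ hcard hP σ n hn hσn h1 h4
    -- fixed commutators are trivial
    have key : ∀ x, σ (x⁻¹ * σ x) = x⁻¹ * σ x → σ x = x := by
      intro x hx
      set c := x⁻¹ * σ x with hc
      have hσx : σ x = x * c := by rw [hc]; group
      have hit : ∀ k : ℕ, σ^[k] x = x * c ^ k := by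
        intro k
        induction k with
        | zero => simp
        | succ k ihk =>
          rw [Function.iterate_succ_apply', ihk, map_mul, map_pow, hx, hσx, pow_succ']; group
      have hcn : c ^ n = 1 := by
        have := hit n
        rw [hσn] at this
        exact (mul_eq_left.mp this.symm)
      have hco : (orderOf c).Coprime n := hP.orderOf_coprime hn c
      have : c = 1 := by
        rw [← orderOf_eq_one_iff]
        exact Nat.Coprime.eq_one_of_dvd hco (orderOf_dvd_of_pow_eq_one hcn)
      rw [hσx, this, mul_one]
    -- proper invariant subgroups are fixed
    have fixH : ∀ H : Subgroup P, H ≠ ⊤ → (∀ x ∈ H, σ x ∈ H) → ∀ x ∈ H, σ x = x := by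
      intro H hH hinv x hx
      have hlt : Nat.card H < Nat.card P := by
        have := Subgroup.card_le_card_group H
        rcases this.lt_or_eq with h | h
        · exact h
        · exact absurd (Subgroup.eq_top_of_card_eq H h) hH
      let τ : H →* H := (σ.comp H.subtype).codRestrict H (fun y => hinv y y.2)
      have hτ : ∀ y : H, ((τ y : H) : P) = σ y := fun y => rfl
      have hit : ∀ k (y : H), ((τ^[k] y : H) : P) = σ^[k] y := by
        intro k
        induction k with
        | zero => intro y; rfl
        | succ k ihk => intro y; rw [Function.iterate_succ_apply', Function.iterate_succ_apply',
            hτ, ihk]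
      have := ih (P := H) (by omega) (hP.to_subgroup H) τ n hn
        (fun y => Subtype.ext (by rw [hit, hσn]))
        (fun y hy => Subtype.ext (by rw [hτ]; exact h1 _ (by rw [← Subgroup.coe_pow, hy]; rfl)))
        (fun h2 y hy => Subtype.ext (by
          rw [hτ]; exact h4 h2 _ (by rw [← Subgroup.coe_pow, hy]; rfl)))
        ⟨x, hx⟩
      exact congrArg Subtype.val this
    let D : Subgroup P := Subgroup.closure (Set.range fun x => x⁻¹ * σ x)
    have hD : ∀ x, x⁻¹ * σ x ∈ D := fun x => Subgroup.subset_closure ⟨x, rfl⟩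
    by_cases hDt : D = ⊤
    swap
    · intro x
      refine key x (fixH D hDt ?_ _ (hD x))
      intro y hy
      have := D.mul_mem hy (hD y)
      simpa using this
    rcases subsingleton_or_nontrivial P with hs | hs
    · intro x; exact Subsingleton.elim _ _
    obtain ⟨F, hF, hcomm, hpow, hchar⟩ := exists_frattini_like hP
    have hFfix := fixH F hF (hchar σ)
    have hFn : F.Normal := Subgroup.Normal.of_commutator_le _ hcomm
    have hFc : ∀ f ∈ F, ∀ g, g * f = f * g := by
      intro f hf g
      have : D ≤ Subgroup.centralizer {f} := by
        rw [Subgroup.closure_le]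
        rintro _ ⟨x, rfl⟩
        rw [SetLike.mem_coe, Subgroup.mem_centralizer_singleton_iff]
        have h := hFfix _ (hFn.conj_mem f hf x)
        rw [map_mul, map_mul, map_inv, hFfix f hf] at h
        have h2 : σ x * f = x * f * x⁻¹ * σ x := by rw [← h]; group
        calc x⁻¹ * σ x * f = x⁻¹ * (σ x * f) := by group
          _ = f * (x⁻¹ * σ x) := by rw [h2]; group
      rw [hDt] at this
      exact Subgroup.mem_centralizer_singleton_iff.mp (this (Subgroup.mem_top g))
    intro x
    apply key
    set c := x⁻¹ * σ x with hc
    have hσx : σ x = x * c := by rw [hc]; group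
    set z := c⁻¹ * x⁻¹ * c * x with hz
    have hzF : z ∈ F := hcomm (by
      have : z = ⁅c⁻¹, x⁻¹⁆ := by rw [hz, commutatorElement_def]; group
      rw [this]
      exact Subgroup.commutator_mem_commutator (Subgroup.mem_top _) (Subgroup.mem_top _))
    have hzc := hFc z hzF
    have hcx : c * x = x * c * z := by rw [hz]; group
    have hzp : z ^ p = 1 := by
      have h1 : ∀ k : ℕ, x⁻¹ * c ^ k * x = c ^ k * z ^ k := by
        intro k
        have : x⁻¹ * c * x = c * z := by rw [mul_assoc, hcx]; group
        have h2 : (x⁻¹ * c * x) ^ k = x⁻¹ * c ^ k * x := by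
          have := conj_pow (a := x⁻¹) (b := c) (i := k)
          simpa using this
        rw [← h2, this]
        exact (show Commute c z from hzc c).mul_pow k
      have h2 := h1 p
      have h3 := hFc _ (hpow c) x⁻¹
      rw [h3] at h2
      have h4 : c ^ p = c ^ p * z ^ p := by rw [← h2]; group
      exact (mul_eq_left.mp h4.symm)
    have hpw : (x * c) ^ p = x ^ p := by
      rw [← hσx, ← map_pow]; exact hFfix _ (hpow x)
    rw [class_two_pow x c z hzc hcx p, mul_assoc, mul_eq_left] at hpw
    rcases hp.out.eq_two_or_odd' with h2 | ⟨k, hk⟩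
    · apply h4 h2
      subst h2
      simp only [Nat.add_one_sub_one, mul_one, Nat.div_self (Nat.zero_lt_two), pow_one] at hpw
      have : c ^ 2 = z⁻¹ := eq_inv_of_mul_eq_one_left hpw
      rw [show 4 = 2 * 2 from rfl, pow_mul, this, inv_pow, hzp, inv_one]
    · apply h1
      have : p * (p - 1) / 2 = p * k := by
        rw [Nat.mul_div_assoc]
        · congr 1; omega
        · exact ⟨k, by omega⟩
      rwa [this, pow_mul, hzp, one_pow, mul_one] at hpw

lemma card_conj_union {S : Type*} [Group S] [Finite S] (M : Subgroup S)
    (hTI : ∀ g m, m ∈ M → m ≠ 1 → g * m * g⁻¹ ∈ M → g ∈ M) :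
    Set.ncard {x : S | x ≠ 1 ∧ ∃ g, g⁻¹ * x * g ∈ M} + M.index = Nat.card S := by
  let f : (S ⧸ M) × {m : M // m ≠ 1} → S := fun a => a.1.out * (a.2 : M) * a.1.out⁻¹
  have hf : Function.Injective f := by
    rintro ⟨a, m⟩ ⟨b, k⟩ hab
    simp only [f] at hab
    have h1 : (b.out⁻¹ * a.out) ∈ M := by
      apply hTI _ (m : M) (m : M).2
      · intro h; exact m.2 (Subtype.ext h)
      · have : b.out⁻¹ * a.out * ((m : M) : S) * (b.out⁻¹ * a.out)⁻¹ = ((k : M) : S) := by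
          calc _ = b.out⁻¹ * (a.out * ((m : M) : S) * a.out⁻¹) * b.out := by group
            _ = _ := by rw [hab]; group
        rw [this]; exact (k : M).2
    have h2 : b = a := by
      rw [← QuotientGroup.out_eq' a, ← QuotientGroup.out_eq' b]
      exact QuotientGroup.eq.mpr h1
    subst h2
    have : ((m : M) : S) = ((k : M) : S) := by simpa using hab
    have h3 : m = k := Subtype.ext (Subtype.ext this)
    rw [h3]
  have hr : Set.range f = {x : S | x ≠ 1 ∧ ∃ g, g⁻¹ * x * g ∈ M} := by
    ext x
    constructor
    · rintro ⟨⟨a, m⟩, rfl⟩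
      refine ⟨?_, a.out, ?_⟩
      · simp only [f]
        intro h
        rw [conj_eq_one_iff] at h
        exact m.2 (Subtype.ext h)
      · simp only [f]
        have : a.out⁻¹ * (a.out * ((m : M) : S) * a.out⁻¹) * a.out = ((m : M) : S) := by group
        rw [this]; exact (m : M).2
    · rintro ⟨hx, g, hg⟩
      obtain ⟨h, hh⟩ := QuotientGroup.mk_out_eq_mul M g
      have hm : (h : S)⁻¹ * (g⁻¹ * x * g) * h ∈ M := M.mul_mem (M.mul_mem (M.inv_mem h.2) hg) h.2
      refine ⟨⟨(g : S ⧸ M), ⟨⟨_, hm⟩, ?_⟩⟩, ?_⟩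
      · intro h1
        have h2 := congrArg Subtype.val h1
        simp only [Subgroup.coe_one] at h2
        apply hx
        have : x = (g * h) * ((h : S)⁻¹ * (g⁻¹ * x * g) * h) * (g * h)⁻¹ := by group
        rw [this, h2]; group
      · simp only [f, hh]; group
  have hcard : Nat.card {m : M // m ≠ 1} + 1 = Nat.card M := by
    have := Set.ncard_add_ncard_compl ({1} : Set M)
    rw [Set.ncard_singleton] at this
    rw [← this, add_comm]; rfl
  rw [← hr, ← Nat.card_coe_set_eq, Nat.card_range_of_injective hf, Nat.card_prod,
    ← M.card_mul_index, ← hcard]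
  change M.index * _ + _ = _
  ring

lemma schmidt_simple {S : Type*} [Group S] [Finite S] [IsSimpleGroup S]
    (h : ∀ H : Subgroup S, H ≠ ⊤ → Group.IsNilpotent H) : Group.IsSolvable S := by
  by_contra hns
  have hz : ∀ x : S, Subgroup.zpowers x ≠ ⊤ := by
    intro x hx
    apply hns
    have : IsCyclic S := ⟨x, fun y => by
      have : y ∈ (⊤ : Subgroup S) := trivial
      rwa [← hx] at this⟩
    apply Group.isSolvable_of_comm
    intro a b
    exact IsCyclic.isMulCommutative.is_comm.comm a b
  have hbot : ∀ M : Subgroup S, IsCoatom M → M ≠ ⊥ := by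
    rintro M hM rfl
    obtain ⟨x, hx⟩ := exists_ne (1 : S)
    refine hz x (hM.2 _ (bot_lt_iff_ne_bot.mpr ?_))
    rwa [Ne, Subgroup.zpowers_eq_bot]
  have hnorm : ∀ M : Subgroup S, M ≠ ⊥ → M ≠ ⊤ → Subgroup.normalizer (M : Set S) ≠ ⊤ := by
    intro M hM hM' hn
    rw [Subgroup.normalizer_eq_top_iff] at hn
    rcases hn.eq_bot_or_eq_top with h | h
    · exact hM h
    · exact hM' h
  have hinter : ∀ D : Subgroup S, ∀ M K : Subgroup S, IsCoatom M → IsCoatom K → M ≠ K →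
      M ⊓ K = D → D = ⊥ := by
    intro D
    induction D using WellFoundedGT.induction with
    | ind D ih =>
    intro M K hM hK hne hD
    by_contra hDb
    have hDt : D ≠ ⊤ := by
      rintro rfl
      exact hM.1 (top_le_iff.mp (hD ▸ inf_le_left))
    obtain ⟨L, hL, hDL⟩ := (eq_top_or_exists_le_coatom (Subgroup.normalizer (D : Set S))).resolve_left
      (hnorm D hDb hDt)
    have aux : ∀ X : Subgroup S, IsCoatom X → D < X → X = L := by
      intro X hX hDX
      by_contra hXL
      have hlt : D < X ⊓ L := by
        have hnil := h X hX.1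
        have hnc := Group.normalizerCondition_of_isNilpotent (G := X)
        have h1 : D.subgroupOf X < ⊤ := by
          rw [lt_top_iff_ne_top]
          intro h; rw [Subgroup.subgroupOf_eq_top] at h; exact hDX.not_ge h
        have h2 := hnc _ h1
        obtain ⟨y, hy, hyD⟩ := SetLike.exists_of_lt h2
        refine lt_of_le_of_ne (le_inf hDX.le (Subgroup.le_normalizer.trans hDL)) ?_
        intro he
        apply hyD
        rw [Subgroup.mem_subgroupOf, he]
        refine ⟨y.2, hDL ?_⟩
        rw [Subgroup.mem_normalizer_iff] at hy ⊢
        intro d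
        constructor
        · intro hd
          exact (hy ⟨d, hDX.le hd⟩).mp hd
        · intro hd
          have hdX : d ∈ X := by
            have := X.mul_mem (X.mul_mem (X.inv_mem y.2) (hDX.le hd)) y.2
            convert this using 1; group
          exact (hy ⟨d, hdX⟩).mpr hd
      have := ih _ hlt X L hX hL hXL rfl
      rw [this] at hlt
      exact not_lt_bot hlt
    have hM' : D < M := by
      refine lt_of_le_of_ne (hD ▸ inf_le_left) ?_
      rintro rfl
      exact hne ((hM.le_iff.mp (inf_eq_left.mp hD)).resolve_left hK.1).symm
    have hK' : D < K := by
      refine lt_of_le_of_ne (hD ▸ inf_le_right) ?_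
      rintro rfl
      exact hne ((hK.le_iff.mp (inf_eq_right.mp hD)).resolve_left hM.1)
    exact hne ((aux M hM hM').trans (aux K hK hK').symm)
  have hconj : ∀ M : Subgroup S, IsCoatom M → ∀ g,
      IsCoatom (M.map (MulAut.conj g).toMonoidHom) := by
    intro M hM g
    exact (OrderIso.isCoatom_iff (MulAut.conj g).mapSubgroup M).mpr hM
  have hclaim : ∀ M K : Subgroup S, IsCoatom M → IsCoatom K → ∀ g m, m ∈ M → m ≠ 1 →
      g * m * g⁻¹ ∈ K → M.map (MulAut.conj g).toMonoidHom = K := by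
    intro M K hM hK g m hm hm1 hgm
    by_contra hne
    have := hinter _ _ _ (hconj M hM g) hK hne rfl
    have hmem : g * m * g⁻¹ ∈ M.map (MulAut.conj g).toMonoidHom ⊓ K :=
      ⟨⟨m, hm, by simp⟩, hgm⟩
    rw [this, Subgroup.mem_bot, conj_eq_one_iff] at hmem
    exact hm1 hmem
  have hTI : ∀ M : Subgroup S, IsCoatom M → ∀ g m, m ∈ M → m ≠ 1 → g * m * g⁻¹ ∈ M → g ∈ M := by
    intro M hM g m hm hm1 hgm
    have h1 := hclaim M M hM hM g m hm hm1 hgm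
    have h2 : Subgroup.normalizer (M : Set S) = M :=
      (hM.le_iff.mp Subgroup.le_normalizer).resolve_left (hnorm M (hbot M hM) hM.1)
    rw [← h2, Subgroup.mem_normalizer_iff]
    intro x
    constructor
    · intro hx
      have : g * x * g⁻¹ ∈ M.map (MulAut.conj g).toMonoidHom := ⟨x, hx, by simp⟩
      rwa [h1] at this
    · intro hx
      rw [← h1] at hx
      obtain ⟨y, hy, hxy⟩ := hx
      have : y = x := by simpa using hxy
      rwa [← this]
  have hcount : ∀ M : Subgroup S, IsCoatom M →
      Nat.card S ≤ 2 * Set.ncard {x : S | x ≠ 1 ∧ ∃ g, g⁻¹ * x * g ∈ M} := by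
    intro M hM
    have h1 := card_conj_union M (hTI M hM)
    have h2 := M.card_mul_index
    have h3 : 1 < Nat.card M := by
      rw [Subgroup.one_lt_card_iff_ne_bot]; exact hbot M hM
    have : 2 * M.index ≤ Nat.card M * M.index := Nat.mul_le_mul_right _ h3
    omega
  obtain ⟨M, hM, -⟩ := (eq_top_or_exists_le_coatom (⊥ : Subgroup S)).resolve_left bot_ne_top
  obtain ⟨x, hx1, hxM⟩ : ∃ x : S, x ≠ 1 ∧ ¬ ∃ g, g⁻¹ * x * g ∈ M := by
    by_contra! hcon
    have h1 := card_conj_union M (hTI M hM)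
    have h2 : {x : S | x ≠ 1 ∧ ∃ g, g⁻¹ * x * g ∈ M} = {1}ᶜ := by
      ext x; simp only [Set.mem_ofPred_eq, Set.mem_compl_iff, Set.mem_singleton_iff]
      exact ⟨fun h => h.1, fun h => ⟨h, hcon x h⟩⟩
    have h3 := Set.ncard_add_ncard_compl ({1} : Set S)
    rw [Set.ncard_singleton] at h3
    rw [h2] at h1
    have : M.index = 1 := by omega
    exact hM.1 (Subgroup.index_eq_one.mp this)
  obtain ⟨K, hK, hxK⟩ := (eq_top_or_exists_le_coatom (Subgroup.zpowers x)).resolve_left (hz x)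
  have hxK' : x ∈ K := hxK (Subgroup.mem_zpowers x)
  have hdisj : Disjoint {x : S | x ≠ 1 ∧ ∃ g, g⁻¹ * x * g ∈ M}
      {x : S | x ≠ 1 ∧ ∃ g, g⁻¹ * x * g ∈ K} := by
    rw [Set.disjoint_left]
    rintro y ⟨hy, a, ha⟩ ⟨-, b, hb⟩
    have h1 := hclaim M K hM hK (b⁻¹ * a) _ ha (by
      intro h
      apply hy
      have : y = a * (a⁻¹ * y * a) * a⁻¹ := by group
      rw [this, h]; group) (by
      have : b⁻¹ * a * (a⁻¹ * y * a) * (b⁻¹ * a)⁻¹ = b⁻¹ * y * b := by group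
      rwa [this])
    rw [← h1] at hxK'
    obtain ⟨w, hw, hwx⟩ := hxK'
    apply hxM
    refine ⟨b⁻¹ * a, ?_⟩
    rw [← hwx]
    simpa [mul_assoc] using hw
  have h1 := Set.ncard_union_eq hdisj
  have h2 : ({x : S | x ≠ 1 ∧ ∃ g, g⁻¹ * x * g ∈ M} ∪
      {x : S | x ≠ 1 ∧ ∃ g, g⁻¹ * x * g ∈ K}).ncard ≤ ({1}ᶜ : Set S).ncard := by
    apply Set.ncard_le_ncard
    rintro y (hy | hy)
    · exact hy.1
    · exact hy.1
    · exact Set.toFinite _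
  have h3 := Set.ncard_add_ncard_compl ({1} : Set S)
  rw [Set.ncard_singleton] at h3
  have h4 := hcount M hM
  have h5 := hcount K hK
  omega

/-- A finite group all of whose proper subgroups are nilpotent is solvable. -/
lemma schmidt (n : ℕ) : ∀ {G : Type*} [Group G] [Finite G] (_ : Nat.card G ≤ n)
    (_ : ∀ H : Subgroup G, H ≠ ⊤ → Group.IsNilpotent H), Group.IsSolvable G := by
  induction n with
  | zero =>
    intro G _ _ hc
    have : 0 < Nat.card G := Nat.card_pos
    omega
  | succ n ih =>
    intro G _ _ hc h
    rcases subsingleton_or_nontrivial G with hs | hs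
    · infer_instance
    by_cases hsimp : IsSimpleGroup G
    · exact schmidt_simple h
    have : ∃ N : Subgroup G, N.Normal ∧ N ≠ ⊥ ∧ N ≠ ⊤ := by
      by_contra! hcon
      exact hsimp ⟨fun N hN => or_iff_not_imp_left.mpr (hcon N hN)⟩
    obtain ⟨N, hN, hb, ht⟩ := this
    rw [Group.isSolvable_iff_subgroup_quotient N]
    have hnil := h N ht
    refine ⟨inferInstance, ih ?_ ?_⟩
    · have h1 := N.card_mul_index
      have h2 := (Subgroup.one_lt_card_iff_ne_bot N).mpr hb
      have h3 : 0 < Nat.card (G ⧸ N) := Nat.card_pos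
      change Nat.card N * Nat.card (G ⧸ N) = _ at h1
      have : 2 * Nat.card (G ⧸ N) ≤ Nat.card N * Nat.card (G ⧸ N) := Nat.mul_le_mul_right _ h2
      omega
    · intro H hH
      have hs : Function.Surjective (QuotientGroup.mk' N) := QuotientGroup.mk'_surjective N
      have h1 : H.comap (QuotientGroup.mk' N) ≠ ⊤ := by
        intro he
        apply hH
        rw [← Subgroup.map_comap_eq_self_of_surjective hs H, he, ← MonoidHom.range_eq_map,
          MonoidHom.range_eq_top.mpr hs]
      have h2 := h _ h1
      exact Group.nilpotent_of_surjective ((QuotientGroup.mk' N).subgroupComap H)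
        ((QuotientGroup.mk' N).subgroupComap_surjective_of_surjective H hs)

lemma mem_of_coprime_pow {G : Type*} [Group G] (M : Subgroup G) {y : G} {a b : ℕ}
    (hab : a.Coprime b) (ha : y ^ a ∈ M) (hb : y ^ b ∈ M) : y ∈ M := by
  have h := Nat.gcd_eq_gcd_ab a b
  rw [hab] at h
  have : y = (y ^ a) ^ (a.gcdA b) * (y ^ b) ^ (a.gcdB b) := by
    rw [← zpow_natCast, ← zpow_natCast, ← zpow_mul, ← zpow_mul, ← zpow_add, ← h]; simp
  rw [this]
  exact M.mul_mem (M.zpow_mem ha _) (M.zpow_mem hb _)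

lemma exists_pcore {G : Type*} [Group G] [Finite G] (N : Subgroup G) [hN : N.Normal]
    [Group.IsNilpotent N] (p : ℕ) [Fact p.Prime] : ∃ P : Subgroup G, P ≤ N ∧ P.Normal ∧
      IsPGroup p P ∧ ∀ y ∈ N, (∃ k, y ^ p ^ k = 1) → y ∈ P := by
  obtain ⟨Q⟩ : Nonempty (Sylow p N) := inferInstance
  have hQn : (Q : Subgroup N).Normal := inferInstance
  have hQc : (Q : Subgroup N).Characteristic := Q.characteristic_of_normal hQn
  refine ⟨(Q : Subgroup N).map N.subtype, Subgroup.map_subtype_le _, inferInstance,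
    Q.isPGroup'.map _, ?_⟩
  rintro y hy ⟨k, hk⟩
  have hz : IsPGroup p (Subgroup.zpowers (⟨y, hy⟩ : N)) := by
    refine IsPGroup.of_card_dvd_pow (n := k) ?_
    rw [Nat.card_zpowers]
    apply orderOf_dvd_of_pow_eq_one
    exact Subtype.ext hk
  obtain ⟨R, hR⟩ := hz.exists_le_sylow
  have := Sylow.unique_of_normal Q hQn
  have hRQ : R = Q := Subsingleton.elim _ _
  rw [hRQ] at hR
  exact ⟨⟨y, hy⟩, hR (Subgroup.mem_zpowers _), rfl⟩

lemma commute_of_coprime_action {G : Type*} [Group G] [Finite G] (P : Subgroup G) [P.Normal]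
    (p : ℕ) [Fact p.Prime] (hP : IsPGroup p P) (x : G) (n : ℕ) (hn : p.Coprime n)
    (hx : x ^ n = 1) (h : ∀ y ∈ P, orderOf y = p ∨ orderOf y = 4 → x * y = y * x) :
    ∀ y ∈ P, x * y = y * x := by
  intro y hy
  have hp : p.Prime := Fact.out
  let σ : P →* P := (MulAut.conjNormal x : MulAut P).toMonoidHom
  have hσ : ∀ z : P, ((σ z : P) : G) = x * z * x⁻¹ := fun z => MulAut.conjNormal_apply x z
  have hit : ∀ (k : ℕ) (z : P), ((σ^[k] z : P) : G) = x ^ k * z * (x ^ k)⁻¹ := by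
    intro k
    induction k with
    | zero => intro z; simp
    | succ k ih => intro z; rw [Function.iterate_succ_apply', hσ, ih, pow_succ']; group
  have fix : ∀ z : P, (z = 1 ∨ orderOf (z : G) = p ∨ orderOf (z : G) = 4) → σ z = z := by
    rintro z (rfl | hz)
    · exact map_one _
    · apply Subtype.ext
      rw [hσ, h z z.2 hz]; group
  have := coprime_fix (Nat.card P) le_rfl hP σ n hn
    (fun z => Subtype.ext (by rw [hit, hx]; simp))
    (fun z hz => fix z (by
      by_cases h1 : z = 1
      · exact Or.inl h1
      · right; left
        rw [Subgroup.orderOf_coe]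
        exact orderOf_eq_prime hz h1))
    (fun h2 z hz => fix z (by
      subst h2
      have hd : orderOf z ∣ 2 ^ 2 := orderOf_dvd_of_pow_eq_one (by simpa using hz)
      rw [Nat.dvd_prime_pow Nat.prime_two] at hd
      obtain ⟨k, hk, hk'⟩ := hd
      rw [Subgroup.orderOf_coe]
      interval_cases k
      · left; exact orderOf_eq_one_iff.mp hk'
      · right; left; simpa using hk'
      · right; right; simpa using hk'))
    ⟨y, hy⟩
  have h2 := congrArg Subtype.val this
  rw [hσ] at h2
  simpa using mul_inv_eq_iff_eq_mul.mp h2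

lemma nilpotent_of_commute {G : Type*} [Group G] [Finite G]
    (h : ∀ p q : ℕ, p.Prime → q.Prime → p ≠ q → ∀ x y : G, (∃ k, x ^ p ^ k = 1) →
      (∃ k, y ^ q ^ k = 1) → x * y = y * x) : Group.IsNilpotent G := by
  refine ((Group.isNilpotent_of_finite_tfae (G := G)).out 0 3).mpr ?_
  intro p hp P
  rw [← Subgroup.normalizer_eq_top_iff, ← Subgroup.index_eq_one]
  by_contra hne
  obtain ⟨q, hq, hqd⟩ := Nat.exists_prime_and_dvd hne
  have : Fact q.Prime := ⟨hq⟩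
  obtain ⟨Q, hQ⟩ : ∃ Q : Sylow q G, (Q : Subgroup G) ≤ Subgroup.normalizer ((P : Subgroup G) : Set G) := by
    by_cases hpq : p = q
    · subst hpq
      exact ⟨P, Subgroup.le_normalizer⟩
    · obtain ⟨Q⟩ : Nonempty (Sylow q G) := inferInstance
      refine ⟨Q, ?_⟩
      intro y hy
      have hc : ∀ x ∈ (P : Subgroup G), y * x * y⁻¹ = x := by
        intro x hx
        obtain ⟨k, hk⟩ := P.isPGroup' ⟨x, hx⟩
        obtain ⟨l, hl⟩ := Q.isPGroup' ⟨y, hy⟩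
        rw [← h p q hp.out hq hpq x y ⟨k, congrArg Subtype.val hk⟩ ⟨l, congrArg Subtype.val hl⟩]
        group
      rw [Subgroup.mem_normalizer_iff]
      intro x
      constructor
      · intro hx; rw [hc x hx]; exact hx
      · intro hx
        have h1 := hc _ hx
        have h2 : y * x * y⁻¹ = x := by
          have := congrArg (fun t => y⁻¹ * t * y) h1
          simpa [mul_assoc] using this
        rwa [h2] at hx
  exact Q.not_dvd_index (hqd.trans (Subgroup.index_dvd_of_le hQ))

/-- Ito's theorem. -/
lemma ito (n : ℕ) : ∀ {G : Type*} [Group G] [Finite G] (_ : Nat.card G ≤ n)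
    (_ : ∀ x : G, (orderOf x).Prime ∨ orderOf x = 4 → ∀ g, g * x = x * g),
    Group.IsNilpotent G := by
  induction n with
  | zero =>
    intro G _ _ hc
    have : 0 < Nat.card G := Nat.card_pos
    omega
  | succ n ih =>
    intro G _ _ hc h
    rcases subsingleton_or_nontrivial G with hs | hs
    · infer_instance
    have hsub : ∀ H : Subgroup G, H ≠ ⊤ → Group.IsNilpotent H := by
      intro H hH
      apply ih
      · have := Subgroup.card_le_card_group H
        rcases this.lt_or_eq with h | h
        · omega
        · exact absurd (Subgroup.eq_top_of_card_eq H h) hH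
      · intro x hx g
        apply Subtype.ext
        rw [← Subgroup.orderOf_coe] at hx
        exact h x hx g
    have hsol := schmidt _ le_rfl hsub
    have hlt := Group.IsSolvable.commutator_lt_top_of_nontrivial G
    obtain ⟨M, hM, hle⟩ := (eq_top_or_exists_le_coatom (commutator G)).resolve_left hlt.ne
    have hMn : M.Normal := Subgroup.Normal.of_commutator_le _ hle
    have hnil := hsub M hM.1
    have main : ∀ p q : ℕ, p.Prime → q.Prime → p ≠ q → ∀ x y : G, (∃ k, x ^ p ^ k = 1) →
      (∃ k, y ^ q ^ k = 1) → x ∈ M → x * y = y * x := by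
      rintro p q hp hq hpq x y hx ⟨l, hl⟩ hxM
      have : Fact p.Prime := ⟨hp⟩
      obtain ⟨P, hPM, hPn, hP, hPx⟩ := exists_pcore M p
      refine (commute_of_coprime_action P p hP y (q ^ l) ?_ hl ?_ x (hPx x hxM hx)).symm
      · exact Nat.Coprime.pow_right _ ((Nat.coprime_primes hp hq).mpr hpq)
      · rintro z hz (h1 | h1)
        · exact h z (Or.inl (h1 ▸ hp)) y
        · exact h z (Or.inr h1) y
    apply nilpotent_of_commute
    rintro p q hp hq hpq x y ⟨k, hk⟩ ⟨l, hl⟩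
    by_cases hxM : x ∈ M
    · exact main p q hp hq hpq x y ⟨k, hk⟩ ⟨l, hl⟩ hxM
    · refine (main q p hq hp hpq.symm y x ⟨l, hl⟩ ⟨k, hk⟩ ?_).symm
      have hsup : M ⊔ Subgroup.zpowers x = ⊤ := by
        apply hM.2
        refine lt_of_le_of_ne le_sup_left ?_
        intro he
        apply hxM
        rw [he]
        exact (le_sup_right : Subgroup.zpowers x ≤ _) (Subgroup.mem_zpowers x)
      have hy : y ∈ M ⊔ Subgroup.zpowers x := hsup ▸ Subgroup.mem_top y
      rw [Subgroup.mem_sup_of_normal_left] at hy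
      obtain ⟨m, hm, z, ⟨j, rfl⟩, rfl⟩ := hy
      refine mem_of_coprime_pow M (a := p ^ k) (b := q ^ l) ?_ ?_ ?_
      · exact Nat.Coprime.pow _ _ ((Nat.coprime_primes hp hq).mpr hpq)
      · rw [← QuotientGroup.eq_one_iff]
        have hm1 : (m : G ⧸ M) = 1 := (QuotientGroup.eq_one_iff m).mpr hm
        simp only [QuotientGroup.mk_pow, QuotientGroup.mk_mul, hm1, one_mul]
        rw [← QuotientGroup.mk_pow, ← zpow_natCast, ← zpow_mul, mul_comm, zpow_mul, zpow_natCast,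
          hk, one_zpow]
        rfl
      · rw [hl]; exact M.one_mem

lemma exists_eigen {p : ℕ} [hp : Fact p.Prime] {A : Type*} [CommGroup A] [Finite A] [Nontrivial A]
    (hA : ∀ w : A, w ^ p = 1) (σ : A →* A) (k : ℕ) (hσ : ∀ w, σ^[(p - 1) * p ^ k] w = w) :
    ∃ a : ℕ, ∃ w : A, w ≠ 1 ∧ σ w = w ^ a := by
  let V := Additive A
  letI : Module (ZMod p) V := AddCommGroup.zmodModule (n := p) (fun x => hA x.toMul)
  let f : Module.End (ZMod p) V := (MonoidHom.toAdditive σ).toZModLinearMap p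
  have hf : ∀ v : V, f v = Additive.ofMul (σ v.toMul) := fun v => rfl
  have hit : ∀ (n : ℕ) (v : V), (f ^ n) v = Additive.ofMul (σ^[n] v.toMul) := by
    intro n
    induction n with
    | zero => intro v; rfl
    | succ n ih =>
      intro v
      rw [pow_succ', Module.End.mul_apply, ih, hf, Function.iterate_succ_apply']; rfl
  have hfn : f ^ ((p - 1) * p ^ k) = 1 := by
    ext v
    rw [hit, hσ]; rfl
  have hann : Polynomial.aeval f ((Polynomial.X ^ p - Polynomial.X : Polynomial (ZMod p)) ^ p ^ k)
      = 0 := by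
    rw [sub_pow_char_pow, map_sub, map_pow, map_pow, map_pow, Polynomial.aeval_X, ← pow_mul]
    have : p * p ^ k = (p - 1) * p ^ k + p ^ k := by
      rw [Nat.sub_mul, one_mul, Nat.sub_add_cancel]
      exact Nat.le_mul_of_pos_left _ hp.out.pos
    rw [this, pow_add, hfn, one_mul, sub_self]
  have hfin : Module.Finite (ZMod p) V := Module.Finite.of_finite
  have hdvd := minpoly.dvd (ZMod p) f hann
  have hspl : (minpoly (ZMod p) f).Splits := by
    refine Polynomial.Splits.of_dvd ((GaloisField.splits_zmod_X_pow_sub_X p).pow _) ?_ hdvd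
    exact pow_ne_zero _ (FiniteField.X_pow_card_sub_X_ne_zero (ZMod p) hp.out.one_lt)
  have hdeg : (minpoly (ZMod p) f).degree ≠ 0 :=
    (minpoly.degree_pos (Algebra.IsIntegral.isIntegral f)).ne'
  obtain ⟨a, ha⟩ := hspl.exists_eval_eq_zero hdeg
  obtain ⟨v, hv⟩ := (Module.End.hasEigenvalue_of_isRoot (f := f) ha).exists_hasEigenvector
  refine ⟨a.val, v.toMul, ?_, ?_⟩
  · intro h
    exact hv.2 (congrArg Additive.ofMul h)
  · have h1 := hv.apply_eq_smul
    rw [hf] at h1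
    have h2 : a • v = (a.val : ℕ) • v := by
      conv_lhs => rw [← ZMod.natCast_zmod_val a]
      exact Nat.cast_smul_eq_nsmul (ZMod p) a.val v
    rw [h2] at h1
    exact congrArg Additive.toMul h1

lemma exists_normal_zpowers {p : ℕ} [hp : Fact p.Prime] {Q : Type*} [Group Q] [Finite Q]
    (P : Subgroup Q) [hPn : P.Normal] (hPb : P ≠ ⊥) (hP : IsPGroup p P)
    (hpow : ∀ g : Q, ∃ k : ℕ, ∀ w ∈ P, g ^ ((p - 1) * p ^ k) * w = w * g ^ ((p - 1) * p ^ k))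
    (hab : ∀ g h : Q, ∀ w ∈ P, (∀ v ∈ P, w * v = v * w) →
      g * (h * w * h⁻¹) * g⁻¹ = h * (g * w * g⁻¹) * h⁻¹) :
    ∃ w ∈ P, w ≠ 1 ∧ (Subgroup.zpowers w).Normal := by
  let S : Set (Subgroup Q) := {W | W ≠ ⊥ ∧ W.Normal ∧ W ≤ P ∧ ∀ w ∈ W, w ^ p = 1 ∧
    ∀ v ∈ P, w * v = v * w}
  have hS : S.Nonempty := by
    let W0 : Subgroup Q :=
      { carrier := {w | w ∈ P ∧ w ^ p = 1 ∧ ∀ v ∈ P, w * v = v * w}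
        one_mem' := ⟨P.one_mem, one_pow _, fun v _ => by simp⟩
        mul_mem' := by
          rintro a b ⟨ha, hap, hac⟩ ⟨hb, hbp, hbc⟩
          refine ⟨P.mul_mem ha hb, ?_, ?_⟩
          · rw [(show Commute a b from hac b hb).mul_pow, hap, hbp, one_mul]
          · intro v hv
            rw [mul_assoc, hbc v hv, ← mul_assoc, hac v hv, mul_assoc]
        inv_mem' := by
          rintro a ⟨ha, hap, hac⟩
          refine ⟨P.inv_mem ha, by rw [inv_pow, hap, inv_one], fun v hv => ?_⟩
          exact (show Commute a v from hac v hv).inv_left }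
    have hW0 : ∀ w, w ∈ W0 ↔ w ∈ P ∧ w ^ p = 1 ∧ ∀ v ∈ P, w * v = v * w := fun w => Iff.rfl
    refine ⟨W0, ?_, ⟨?_⟩, fun w hw => hw.1, fun w hw => hw.2⟩
    · have : Nontrivial P := (Subgroup.nontrivial_iff_ne_bot P).mpr hPb
      have hcn := hP.center_nontrivial
      have hcp : IsPGroup p (Subgroup.center P) := hP.to_subgroup _
      have hd : p ∣ Nat.card (Subgroup.center P) := by
        rcases hcp.card_eq_or_dvd with h | h
        · exact absurd h (Finite.one_lt_card).ne'
        · exact h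
      obtain ⟨w, hw⟩ := exists_prime_orderOf_dvd_card' p hd
      intro hb
      have hmem : ((w : P) : Q) ∈ W0 := by
        refine ⟨(w : P).2, ?_, ?_⟩
        · have : w ^ p = 1 := hw ▸ pow_orderOf_eq_one w
          exact congrArg (fun t : Subgroup.center P => ((t : P) : Q)) this
        · intro v hv
          have := Subgroup.mem_center_iff.mp w.2 ⟨v, hv⟩
          exact (congrArg Subtype.val this).symm
      rw [hb, Subgroup.mem_bot] at hmem
      have : w = 1 := Subtype.ext (Subtype.ext hmem)
      rw [this, orderOf_one] at hw
      exact hp.out.one_lt.ne hw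
    · intro w hw g
      rw [hW0] at hw ⊢
      obtain ⟨h1, h2, h3⟩ := hw
      refine ⟨hPn.conj_mem w h1 g, by rw [conj_pow, h2]; group, fun v hv => ?_⟩
      have h4 := h3 _ (hPn.conj_mem v hv g⁻¹)
      have h5 := congrArg (fun t => g * t * g⁻¹) h4
      simpa [mul_assoc] using h5
  obtain ⟨W, ⟨hWb, hWn, hWP, hW⟩, hmin⟩ := (Set.toFinite S).exists_minimal hS
  have hact : ∀ g : Q, ∃ a : ℕ, ∀ w ∈ W, g * w * g⁻¹ = w ^ a := by
    intro g
    obtain ⟨k, hk⟩ := hpow g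
    letI : CommGroup W :=
      { (inferInstance : Group W) with
        mul_comm := fun a b => Subtype.ext ((hW a a.2).2 b (hWP b.2)) }
    have : Nontrivial W := (Subgroup.nontrivial_iff_ne_bot W).mpr hWb
    let σ : W →* W := (MulAut.conjNormal g : MulAut W).toMonoidHom
    have hσ : ∀ z : W, ((σ z : W) : Q) = g * z * g⁻¹ := fun z => MulAut.conjNormal_apply g z
    have hit : ∀ (k : ℕ) (z : W), ((σ^[k] z : W) : Q) = g ^ k * z * (g ^ k)⁻¹ := by
      intro k
      induction k with
      | zero => intro z; simp
      | succ k ih => intro z; rw [Function.iterate_succ_apply', hσ, ih, pow_succ']; group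
    obtain ⟨a, w, hw1, hw⟩ := exists_eigen (p := p) (A := W)
      (fun w => Subtype.ext (hW w w.2).1) σ k
      (fun w => Subtype.ext (by rw [hit, hk w (hWP w.2)]; group))
    refine ⟨a, ?_⟩
    let W' : Subgroup Q :=
      { carrier := {w | w ∈ W ∧ g * w * g⁻¹ = w ^ a}
        one_mem' := ⟨W.one_mem, by simp⟩
        mul_mem' := by
          rintro x y ⟨hx, hx'⟩ ⟨hy, hy'⟩
          refine ⟨W.mul_mem hx hy, ?_⟩
          rw [(show Commute x y from (hW x hx).2 y (hWP hy)).mul_pow, ← hx', ← hy']; group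
        inv_mem' := by
          rintro x ⟨hx, hx'⟩
          refine ⟨W.inv_mem hx, ?_⟩
          rw [inv_pow, ← hx']; group }
    have hle : W' ≤ W := fun w hw => hw.1
    have hW'S : W' ∈ S := by
      refine ⟨?_, ⟨?_⟩, hle.trans hWP, fun w hw => hW w hw.1⟩
      · intro hb
        have hmem : (w : Q) ∈ W' := ⟨w.2, by rw [← hσ, hw]; rfl⟩
        rw [hb, Subgroup.mem_bot] at hmem
        exact hw1 (Subtype.ext hmem)
      · rintro v ⟨hv, hv'⟩ h
        refine ⟨hWn.conj_mem v hv h, ?_⟩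
        rw [hab g h v (hWP hv) (hW v hv).2, hv', conj_pow]
    intro w hw
    exact (hmin hW'S hle hw).2
  obtain ⟨⟨w, hw⟩, hw1'⟩ := Subgroup.ne_bot_iff_exists_ne_one.mp hWb
  have hw1 : w ≠ 1 := fun h => hw1' (Subtype.ext h)
  refine ⟨w, hWP hw, hw1, ⟨?_⟩⟩
  intro v hv g
  obtain ⟨a, ha⟩ := hact g
  have hvW : v ∈ W := (Subgroup.zpowers_le.mpr hw) hv
  rw [ha v hvW]
  exact Subgroup.pow_mem _ hv a

lemma supersolvable_of_step {G : Type*} [Group G] [Finite G]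
    (h : ∀ K : Subgroup G, K.Normal → K ≠ ⊤ → ∃ x, x ∉ K ∧ (K ⊔ Subgroup.zpowers x).Normal) :
    IsSupersolvable G := by
  classical
  have h' : ∀ K : {K : Subgroup G // K.Normal}, ∃ K' : {K : Subgroup G // K.Normal},
      ∃ x, (K : Subgroup G) ⊔ Subgroup.zpowers x = K' ∧
        ((K : Subgroup G) ≠ ⊤ → (K : Subgroup G) < K') := by
    rintro ⟨K, hK⟩
    by_cases hT : K = ⊤
    · exact ⟨⟨K, hK⟩, 1, by simp, fun h => absurd hT h⟩
    · obtain ⟨x, hx, hn⟩ := h K hK hT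
      refine ⟨⟨_, hn⟩, x, rfl, fun _ => lt_of_le_of_ne le_sup_left ?_⟩
      intro he
      apply hx
      change K = K ⊔ Subgroup.zpowers x at he
      rw [he]
      exact (le_sup_right : Subgroup.zpowers x ≤ _) (Subgroup.mem_zpowers x)
  choose nxt gen hgen hlt using h'
  let c : ℕ → {K : Subgroup G // K.Normal} := fun n => nxt^[n] ⟨⊥, inferInstance⟩
  have hc : ∀ i, c (i + 1) = nxt (c i) := fun i => Function.iterate_succ_apply' _ _ _
  have hle : ∀ i, (c i : Subgroup G) ≤ c (i + 1) := by
    intro i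
    rw [hc, ← hgen]; exact le_sup_left
  have hcard : ∀ i, (c i : Subgroup G) = ⊤ ∨ i < Nat.card (c i : Subgroup G) := by
    intro i
    induction i with
    | zero => right; exact Nat.card_pos
    | succ i ih =>
      by_cases hT : (c i : Subgroup G) = ⊤
      · left; exact top_le_iff.mp (hT ▸ hle i)
      · right
        have h1 := ih.resolve_left hT
        have h2 := hlt (c i) hT
        rw [← hc] at h2
        have h3 : Nat.card (c i : Subgroup G) < Nat.card (c (i + 1) : Subgroup G) :=
          Set.ncard_lt_ncard (s := ((c i : Subgroup G) : Set G)) h2 (Set.toFinite _)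
        omega
  refine ⟨Nat.card G, fun i => c i, rfl, ?_, hle, fun i => (c i).2, ?_⟩
  · refine (hcard _).resolve_right ?_
    have := Subgroup.card_le_card_group (c (Nat.card G) : Subgroup G)
    omega
  · intro i
    refine ⟨gen (c i), ?_, ?_⟩
    · change _ ∈ (c (i + 1) : Subgroup G)
      rw [hc, ← hgen]
      exact (le_sup_right : Subgroup.zpowers _ ≤ _) (Subgroup.mem_zpowers _)
    · change _ = (c (i + 1) : Subgroup G)
      rw [hc, ← hgen]

lemma zpowers_normal_of_cnormal {G : Type*} [Group G] (x : G) (hx : x ∈ commutator G)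
    (h : (Subgroup.zpowers x).IsCNormal) : (Subgroup.zpowers x).Normal := by
  obtain ⟨T, hT, hHT, hcore⟩ := h
  have hq : ∀ g : G, ∃ a : ℤ, (g : G ⧸ T) = (x : G ⧸ T) ^ a := by
    intro g
    have : g ∈ ((Subgroup.zpowers x : Subgroup G) : Set G) * (T : Set G) := by
      rw [hHT]; trivial
    obtain ⟨_, ⟨a, rfl⟩, t, ht, rfl⟩ := this
    refine ⟨a, ?_⟩
    have ht1 : (t : G ⧸ T) = 1 := (QuotientGroup.eq_one_iff t).mpr ht
    simp [ht1]
  have hle : commutator G ≤ T := by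
    rw [commutator_def, Subgroup.commutator_le]
    intro g _ k _
    obtain ⟨a, ha⟩ := hq g
    obtain ⟨b, hb⟩ := hq k
    rw [← QuotientGroup.eq_one_iff, commutatorElement_def]
    simp only [QuotientGroup.mk_mul, QuotientGroup.mk_inv, ha, hb]
    group
  have h1 : Subgroup.zpowers x ≤ (Subgroup.zpowers x).normalCore :=
    (le_inf le_rfl (Subgroup.zpowers_le.mpr (hle hx))).trans hcore
  have h2 := le_antisymm h1 (Subgroup.normalCore_le _)
  rw [h2]
  infer_instance

lemma conj_eq_pow {G : Type*} [Group G] [Finite G] (x : G) (h : (Subgroup.zpowers x).Normal)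
    (g : G) : ∃ a : ℕ, g * x * g⁻¹ = x ^ a := by
  have := h.conj_mem x (Subgroup.mem_zpowers x) g
  rw [← mem_powers_iff_mem_zpowers] at this
  obtain ⟨a, ha⟩ := this
  exact ⟨a, ha.symm⟩

lemma conj_pow_iterate {G : Type*} [Group G] {g x : G} {a : ℕ} (h : g * x * g⁻¹ = x ^ a) (n : ℕ) :
    g ^ n * x * (g ^ n)⁻¹ = x ^ (a ^ n) := by
  induction n with
  | zero => simp
  | succ n ih =>
    calc g ^ (n + 1) * x * (g ^ (n + 1))⁻¹ = g * (g ^ n * x * (g ^ n)⁻¹) * g⁻¹ := by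
          rw [pow_succ']; group
      _ = (g * x * g⁻¹) ^ (a ^ n) := by rw [ih, conj_pow]
      _ = _ := by rw [h, ← pow_mul, pow_succ']

lemma pow_commute_of_totient {G : Type*} [Group G] [Finite G] (x : G)
    (h : (Subgroup.zpowers x).Normal) (g : G) (e : ℕ) (he : Nat.totient (orderOf x) ∣ e) :
    g ^ e * x = x * g ^ e := by
  obtain ⟨a, ha⟩ := conj_eq_pow x h g
  have hord : orderOf (x ^ a) = orderOf x := by
    rw [← ha]
    exact orderOf_injective (MulAut.conj g).toMonoidHom (MulAut.conj g).injective x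
  have hpos : 0 < orderOf x := orderOf_pos x
  have hcop : a.Coprime (orderOf x) := by
    rw [orderOf_pow] at hord
    have h1 := Nat.div_mul_cancel (Nat.gcd_dvd_left (orderOf x) a)
    rw [hord] at h1
    rw [Nat.coprime_comm]
    exact Nat.eq_of_mul_eq_mul_left hpos (by rw [h1, mul_one])
  obtain ⟨d, rfl⟩ := he
  have h2 : a ^ (Nat.totient (orderOf x) * d) ≡ 1 [MOD orderOf x] := by
    rw [pow_mul]
    simpa using (Nat.ModEq.pow_totient hcop).pow d
  have h3 := conj_pow_iterate ha (Nat.totient (orderOf x) * d)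
  rw [pow_eq_pow_iff_modEq.mpr h2, pow_one] at h3
  exact mul_inv_eq_iff_eq_mul.mp h3

lemma commutator_centralizes {G : Type*} [Group G] [Finite G] (x : G)
    (h : (Subgroup.zpowers x).Normal) (n : G) (hn : n ∈ commutator G) : n * x = x * n := by
  have : commutator G ≤ Subgroup.centralizer {x} := by
    rw [commutator_def, Subgroup.commutator_le]
    intro g _ k _
    rw [Subgroup.mem_centralizer_singleton_iff, commutatorElement_def]
    obtain ⟨a, ha⟩ := conj_eq_pow x h g
    obtain ⟨b, hb⟩ := conj_eq_pow x h k
    have h1 : g * k * x * (g * k)⁻¹ = k * g * x * (k * g)⁻¹ := by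
      calc g * k * x * (g * k)⁻¹ = g * (k * x * k⁻¹) * g⁻¹ := by group
        _ = (g * x * g⁻¹) ^ b := by rw [hb, conj_pow]
        _ = (k * x * k⁻¹) ^ a := by rw [ha, hb, ← pow_mul, ← pow_mul, mul_comm]
        _ = k * (g * x * g⁻¹) * k⁻¹ := by rw [ha, conj_pow]
        _ = _ := by group
    have h2 : ∀ y : G, g * k * y * (g * k)⁻¹ = k * g * y * (k * g)⁻¹ →
        g * k * y = k * g * y * (k * g)⁻¹ * (g * k) := by
      intro y hy; rw [← hy]; group
    -- apply the same with `x` replaced by its conjugate by `(k * g)⁻¹`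
    have hx' : ∃ c : ℕ, (k * g)⁻¹ * x * (k * g) = x ^ c := by
      obtain ⟨c, hc⟩ := conj_eq_pow x h (k * g)⁻¹
      exact ⟨c, by simpa using hc⟩
    obtain ⟨c, hc⟩ := hx'
    have h3 : g * k * x ^ c * (g * k)⁻¹ = k * g * x ^ c * (k * g)⁻¹ := by
      rw [← conj_pow, ← conj_pow, h1]
    have h4 : k * g * x ^ c * (k * g)⁻¹ = x := by rw [← hc]; group
    rw [h4, ← hc] at h3
    have h5 : g * k * g⁻¹ * k⁻¹ * x = (g * k * ((k * g)⁻¹ * x * (k * g)) * (g * k)⁻¹)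
        * (g * k * g⁻¹ * k⁻¹) := by group
    rw [h5, h3]
  exact Subgroup.mem_centralizer_singleton_iff.mp (this hn)

theorem stmt6 {G : Type*} [Group G] [Fintype G]
    (h : ∀ H : Subgroup G, IsCyclic H →
      ((∃ q : ℕ, q.Prime ∧ Nat.card H = q) ∨ Nat.card H = 4) → H.IsCNormal) :
    IsSupersolvable G := by
  have hnorm : ∀ x ∈ commutator G, (orderOf x).Prime ∨ orderOf x = 4 →
      (Subgroup.zpowers x).Normal := by
    intro x hx ho
    apply zpowers_normal_of_cnormal x hx
    apply h _ inferInstance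
    rw [Nat.card_zpowers]
    exact ho.imp (fun h => ⟨_, h, rfl⟩) id
  have hcent : ∀ x ∈ commutator G, (orderOf x).Prime ∨ orderOf x = 4 →
      ∀ n ∈ commutator G, n * x = x * n := fun x hx ho n hn =>
    commutator_centralizes x (hnorm x hx ho) n hn
  have hnil : Group.IsNilpotent (commutator G) := by
    apply ito _ le_rfl
    intro x hx g
    rw [← Subgroup.orderOf_coe] at hx
    exact Subtype.ext (hcent x x.2 hx g g.2)
  apply supersolvable_of_step
  intro K hK hKt
  by_cases hNK : commutator G ≤ K
  · obtain ⟨x, hx⟩ : ∃ x, x ∉ K := by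
      by_contra! hcon
      exact hKt (eq_top_iff.mpr fun x _ => hcon x)
    exact ⟨x, hx, Subgroup.Normal.of_commutator_le _ (hNK.trans le_sup_left)⟩
  -- a prime `p` and a `p`-element of the commutator subgroup outside `K`
  obtain ⟨p, hp, y, hyN, hyp, hyK⟩ : ∃ p : ℕ, p.Prime ∧ ∃ y ∈ commutator G,
      (∃ k, y ^ p ^ k = 1) ∧ y ∉ K := by
    by_contra! hcon
    apply hNK
    have key : ∀ m : ℕ, ∀ y ∈ commutator G, orderOf y ≤ m → y ∈ K := by
      intro m
      induction m with
      | zero =>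
        intro y _ hy
        have := orderOf_pos y
        omega
      | succ m ih =>
        intro y hy hym
        by_cases h1 : orderOf y = 1
        · rw [orderOf_eq_one_iff] at h1
          rw [h1]; exact K.one_mem
        obtain ⟨p, hp, hpd⟩ := Nat.exists_prime_and_dvd h1
        obtain ⟨k, n, hn, hkn⟩ := Nat.exists_eq_pow_mul_and_not_dvd (orderOf_pos y).ne' p hp.ne_one
        have hk : k ≠ 0 := by
          rintro rfl
          rw [pow_zero, one_mul] at hkn
          exact hn (hkn ▸ hpd)
        have hcop : (p ^ k).Coprime n := Nat.Coprime.pow_left _ ((Nat.Prime.coprime_iff_not_dvd hp).mpr hn)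
        refine mem_of_coprime_pow K hcop ?_ ?_
        · apply ih _ (Subgroup.pow_mem _ hy _)
          rw [orderOf_pow_of_dvd (pow_ne_zero _ hp.ne_zero) ⟨n, hkn⟩]
          have : orderOf y / p ^ k < orderOf y :=
            Nat.div_lt_self (orderOf_pos y) (Nat.one_lt_pow hk hp.one_lt)
          omega
        · apply hcon p hp _ (Subgroup.pow_mem _ hy _)
          refine ⟨k, ?_⟩
          rw [← pow_mul, mul_comm, ← hkn, pow_orderOf_eq_one]
    intro y hy
    exact key _ y hy le_rfl
  have : Fact p.Prime := ⟨hp⟩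
  obtain ⟨P, hPN, hPn, hP, hPmem⟩ := exists_pcore (commutator G) p
  have hyP := hPmem y hyN hyp
  -- elements of order prime to `p` acting trivially on elements of order `p` and `4`
  have hsplit : ∀ u : G, (∀ z ∈ P, orderOf z = p ∨ orderOf z = 4 → u * z = z * u) →
      ∃ k n : ℕ, (p ^ k).Coprime n ∧ u ^ (p ^ k * n) = 1 ∧
        ∀ z ∈ P, u ^ p ^ k * z = z * u ^ p ^ k := by
    intro u hu
    obtain ⟨k, n, hn, hkn⟩ := Nat.exists_eq_pow_mul_and_not_dvd (orderOf_pos u).ne' p hp.ne_one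
    have hc := (Nat.Prime.coprime_iff_not_dvd hp).mpr hn
    have h1 : u ^ (p ^ k * n) = 1 := by rw [← hkn, pow_orderOf_eq_one]
    refine ⟨k, n, Nat.Coprime.pow_left _ hc, h1, ?_⟩
    apply commute_of_coprime_action P p hP (u ^ p ^ k) n hc (by rw [← pow_mul, h1])
    intro z hz ho
    exact (show Commute u z from hu z hz ho).pow_left _
  have hord : ∀ z : G, orderOf z = p ∨ orderOf z = 4 → (orderOf z).Prime ∨ orderOf z = 4 :=
    fun z hz => hz.imp (fun h1 => by rw [h1]; exact hp) id
  have hpowG : ∀ g : G, ∃ k : ℕ, ∀ w ∈ P,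
      g ^ ((p - 1) * p ^ k) * w = w * g ^ ((p - 1) * p ^ k) := by
    intro g
    obtain ⟨k, n, -, -, hk⟩ := hsplit (g ^ ((p - 1) * p)) (by
      intro z hz ho
      apply pow_commute_of_totient z (hnorm z (hPN hz) (hord z ho))
      rcases ho with h1 | h1
      · rw [h1, Nat.totient_prime hp]; exact Dvd.intro _ rfl
      · rw [h1, show Nat.totient 4 = 2 from by decide]
        have := (Nat.even_mul_pred_self p).two_dvd
        rwa [mul_comm] at this)
    refine ⟨k + 1, fun w hw => ?_⟩
    have := hk w hw
    rwa [← pow_mul, mul_assoc, ← pow_succ'] at this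
  let π := QuotientGroup.mk' K
  have hs : Function.Surjective π := QuotientGroup.mk'_surjective K
  have hPbn : (P.map π).Normal := hPn.map π hs
  obtain ⟨w, hwP, hw1, hwn⟩ := exists_normal_zpowers (p := p) (P.map π) (by
      intro hb
      have : π y ∈ P.map π := ⟨y, hyP, rfl⟩
      rw [hb, Subgroup.mem_bot] at this
      exact hyK ((QuotientGroup.eq_one_iff y).mp this))
    (hP.map π)
    (by
      intro g
      obtain ⟨g, rfl⟩ := hs g
      obtain ⟨k, hk⟩ := hpowG g
      refine ⟨k, ?_⟩
      rintro _ ⟨w, hw, rfl⟩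
      rw [← map_pow, ← map_mul, hk w hw, map_mul])
    (by
      intro g k w hw hc
      obtain ⟨g, rfl⟩ := hs g
      obtain ⟨k, rfl⟩ := hs k
      have hN : ∀ n ∈ commutator G, n ∈ (Subgroup.centralizer {w}).comap π := by
        intro n hn
        obtain ⟨a, b, hab, h1, hz⟩ := hsplit n
          (fun z hz ho => hcent z (hPN hz) (hord z ho) n hn)
        refine mem_of_coprime_pow _ hab ?_ ?_
        · rw [Subgroup.mem_comap, Subgroup.mem_centralizer_singleton_iff]
          obtain ⟨w, hw, rfl⟩ := hw
          rw [← map_mul, hz w hw, map_mul]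
        · have hnP : n ^ b ∈ P := hPmem _ (Subgroup.pow_mem _ hn _)
            ⟨a, by rw [← pow_mul, mul_comm, h1]⟩
          rw [Subgroup.mem_comap, Subgroup.mem_centralizer_singleton_iff]
          exact (hc _ ⟨_, hnP, rfl⟩).symm
      have h1 := hN (k⁻¹ * g⁻¹ * k * g) (by
        have : k⁻¹ * g⁻¹ * k * g = ⁅k⁻¹, g⁻¹⁆ := by rw [commutatorElement_def]; group
        rw [this]
        exact Subgroup.commutator_mem_commutator (Subgroup.mem_top _) (Subgroup.mem_top _))
      rw [Subgroup.mem_comap, Subgroup.mem_centralizer_singleton_iff] at h1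
      simp only [map_mul, map_inv] at h1
      generalize π g = g at h1 ⊢
      generalize π k = k at h1 ⊢
      calc g * (k * w * k⁻¹) * g⁻¹ = g * k * (w * (k⁻¹ * g⁻¹ * k * g)) * g⁻¹ * k⁻¹ := by group
        _ = _ := by rw [← h1]; group)
  obtain ⟨x, rfl⟩ := hs w
  refine ⟨x, fun hx => hw1 ((QuotientGroup.eq_one_iff x).mpr hx), ?_⟩
  have : K ⊔ Subgroup.zpowers x = (Subgroup.zpowers (π x)).comap π := by
    rw [← MonoidHom.map_zpowers, Subgroup.comap_map_eq, QuotientGroup.ker_mk', sup_comm]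
  rw [this]
  infer_instance
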